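/- arXiv:2207.09256 — 2 statements merged into one kernel-verified Lean document; each statement's English description precedes it below -/
import Mathlib

section
/- (Nakayama's lemma for Dirac rings.) Let A be a local Dirac ring with maximal graded ideal 𝔪 ⊆ A. Let M be a graded A-module that is generated as an A-module by finitely many homogeneous elements. If 𝔪·M = M, i.e. every element of M is a finite sum of products m·x with m ∈ 𝔪 and x ∈ M, then M = 0. -/
/-- A Dirac ring: a `ℤ`-graded ring satisfying the Koszul sign rule. -/
class DiracRing {A : Type*} [Ring A] (𝒜 : ℤ → AddSubgroup A) extends GradedRing 𝒜 where
  koszul : ∀ {i j : ℤ} {a b : A}, a ∈ 𝒜 i → b ∈ 𝒜 j →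
    a * b = (((-1 : ℤˣ) ^ (i * j) : ℤˣ) : ℤ) • (b * a)

/-- A graded ideal: a (left) ideal closed under taking homogeneous components. -/
def Ideal.IsDiracGraded {A : Type*} [Ring A] (𝒜 : ℤ → AddSubgroup A) [DiracRing 𝒜]
    (I : Ideal A) : Prop :=
  ∀ x ∈ I, ∀ k : ℤ, ((DirectSum.decompose 𝒜 x) k : A) ∈ I

/-- In a Dirac ring, a graded left ideal absorbs multiplication on the right. -/
theorem Ideal.IsDiracGraded.mul_mem_right {A : Type*} [Ring A] {𝒜 : ℤ → AddSubgroup A}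
    [DiracRing 𝒜] {I : Ideal A} (hI : I.IsDiracGraded 𝒜) {a : A} (ha : a ∈ I) (b : A) :
    a * b ∈ I := by
  classical
  rw [← DirectSum.sum_support_decompose 𝒜 a, Finset.sum_mul]
  refine I.sum_mem fun i _ => ?_
  rw [← DirectSum.sum_support_decompose 𝒜 b, Finset.mul_sum]
  refine I.sum_mem fun j _ => ?_
  rw [DiracRing.koszul (SetLike.coe_mem (DirectSum.decompose 𝒜 a i))
    (SetLike.coe_mem (DirectSum.decompose 𝒜 b j))]
  exact zsmul_mem (I.mul_mem_left _ (hI a ha i)) _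

/-- The left ideal generated by an element of degree zero is graded. -/
theorem Ideal.isDiracGraded_span_singleton {A : Type*} [Ring A] {𝒜 : ℤ → AddSubgroup A}
    [DiracRing 𝒜] {c : A} (hc : c ∈ 𝒜 0) : (Ideal.span {c}).IsDiracGraded 𝒜 := by
  intro x hx k
  obtain ⟨a, rfl⟩ := Submodule.mem_span_singleton.mp hx
  have h := DirectSum.coe_decompose_mul_add_of_right_mem 𝒜 (i := k) (a := a) hc
  rw [add_zero] at h
  rw [smul_eq_mul, h]
  exact Ideal.mul_mem_left _ _ (Ideal.mem_span_singleton_self c)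

/-- Every proper graded ideal lies in a maximal graded ideal. -/
theorem Ideal.IsDiracGraded.exists_le_maximal {A : Type*} [Ring A] {𝒜 : ℤ → AddSubgroup A}
    [DiracRing 𝒜] {I : Ideal A} (hI : I.IsDiracGraded 𝒜) (hne : I ≠ ⊤) :
    ∃ J : Ideal A, I ≤ J ∧ Maximal (fun J : Ideal A => J.IsDiracGraded 𝒜 ∧ J ≠ ⊤) J := by
  refine zorn_le_nonempty₀ {J : Ideal A | J.IsDiracGraded 𝒜 ∧ J ≠ ⊤} ?_ I ⟨hI, hne⟩
  intro c hc hchain J hJ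
  have hmem {x : A} : x ∈ sSup c ↔ ∃ K ∈ c, x ∈ K :=
    Submodule.mem_sSup_of_directed ⟨J, hJ⟩ hchain.directedOn
  refine ⟨sSup c, ⟨fun x hx k => ?_, fun htop => ?_⟩, fun K hK => le_sSup hK⟩
  · obtain ⟨K, hK, hxK⟩ := hmem.mp hx
    exact hmem.mpr ⟨K, hK, (hc hK).1 x hxK k⟩
  · obtain ⟨K, hK, h_one⟩ := hmem.mp ((Ideal.eq_top_iff_one _).mp htop)
    exact (hc hK).2 ((Ideal.eq_top_iff_one _).mpr h_one)

/-- The component of degree `k` of `a • x`, where `x` is homogeneous of degree `j`. -/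
theorem DirectSum.coe_decompose_smul_of_right_mem {A M : Type*} [Ring A]
    (𝒜 : ℤ → AddSubgroup A) [DirectSum.Decomposition 𝒜] [AddCommGroup M] [Module A M]
    (ℳ : ℤ → AddSubgroup M) [DirectSum.Decomposition ℳ]
    (hsmul : ∀ (i j : ℤ) (a : A) (x : M), a ∈ 𝒜 i → x ∈ ℳ j → a • x ∈ ℳ (i + j))
    (a : A) {x : M} {j : ℤ} (hx : x ∈ ℳ j) (k : ℤ) :
    (DirectSum.decompose ℳ (a • x) k : M) = (DirectSum.decompose 𝒜 a (k - j) : A) • x := by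
  induction a using DirectSum.Decomposition.inductionOn 𝒜 with
  | zero => simp
  | @homogeneous i a =>
    have h := hsmul i j a x a.2 hx
    by_cases hk : i + j = k
    · subst hk
      rw [DirectSum.decompose_of_mem_same ℳ h, add_sub_cancel_right,
        DirectSum.decompose_of_mem_same 𝒜 a.2]
    · rw [DirectSum.decompose_of_mem_ne ℳ h hk,
        DirectSum.decompose_of_mem_ne 𝒜 a.2 (by omega), zero_smul]
  | add a b ha hb => simp [add_smul, DirectSum.decompose_add, ha, hb]

/-- A submodule generated by homogeneous elements contains the homogeneous components of its
elements. -/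
theorem DirectSum.coe_decompose_mem_span {A M : Type*} [Ring A]
    (𝒜 : ℤ → AddSubgroup A) [DirectSum.Decomposition 𝒜] [AddCommGroup M] [Module A M]
    (ℳ : ℤ → AddSubgroup M) [DirectSum.Decomposition ℳ]
    (hsmul : ∀ (i j : ℤ) (a : A) (x : M), a ∈ 𝒜 i → x ∈ ℳ j → a • x ∈ ℳ (i + j))
    {s : Set M} (hs : ∀ x ∈ s, ∃ k : ℤ, x ∈ ℳ k) {w : M} (hw : w ∈ Submodule.span A s) (k : ℤ) :
    (DirectSum.decompose ℳ w k : M) ∈ Submodule.span A s := by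
  suffices h : ∀ a : A, (DirectSum.decompose ℳ (a • w) k : M) ∈ Submodule.span A s by
    simpa using h 1
  induction hw using Submodule.span_induction with
  | mem x hx =>
    intro a
    obtain ⟨j, hj⟩ := hs x hx
    rw [DirectSum.coe_decompose_smul_of_right_mem 𝒜 ℳ hsmul a hj]
    exact Submodule.smul_mem _ _ (Submodule.subset_span hx)
  | zero => simp
  | add x y _ _ hx hy =>
    intro a
    simpa [smul_add, DirectSum.decompose_add] using add_mem (hx a) (hy a)
  | smul b x _ hx =>
    intro a
    simpa [smul_smul] using hx (a * b)

/-- Nakayama's lemma for Dirac rings: let `A` be a local Dirac ring with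
maximal graded ideal `𝔪` (i.e. `𝔪` is a maximal graded ideal and is the unique one), and
let `M` be a graded `A`-module generated by finitely many homogeneous elements.  If
`𝔪·M = M` then `M = 0`. -/
theorem dirac_nakayama
    {A : Type*} [Ring A] (𝒜 : ℤ → AddSubgroup A) [DiracRing 𝒜]
    (m : Ideal A) (hgr : Ideal.IsDiracGraded 𝒜 m) (hne : m ≠ ⊤)
    (hmax : ∀ J : Ideal A, Ideal.IsDiracGraded 𝒜 J → J ≠ ⊤ → m ≤ J → J = m)
    (huniq : ∀ m' : Ideal A, Ideal.IsDiracGraded 𝒜 m' → m' ≠ ⊤ →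
      (∀ J : Ideal A, Ideal.IsDiracGraded 𝒜 J → J ≠ ⊤ → m' ≤ J → J = m') → m' = m)
    {M : Type*} [AddCommGroup M] [Module A M]
    (ℳ : ℤ → AddSubgroup M) [DirectSum.Decomposition ℳ]
    (hsmul : ∀ (i j : ℤ) (a : A) (x : M), a ∈ 𝒜 i → x ∈ ℳ j → a • x ∈ ℳ (i + j))
    (hfg : ∃ s : Finset M, (∀ x ∈ s, ∃ k : ℤ, x ∈ ℳ k) ∧
      Submodule.span A (s : Set M) = ⊤)
    (hmM : ∀ y : M, y ∈ AddSubmonoid.closure {z : M | ∃ a ∈ m, ∃ x : M, z = a • x}) :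
    ∀ y : M, y = 0 := by
  have hinv {c : A} (hc : c ∈ m) (hc0 : c ∈ 𝒜 0) : ∃ u : A, u * (1 - c) = 1 := by
    by_contra! h
    have hproper : Ideal.span {1 - c} ≠ ⊤ := fun htop => by
      obtain ⟨u, hu⟩ := Submodule.mem_span_singleton.mp ((Ideal.eq_top_iff_one _).mp htop)
      exact h u hu
    obtain ⟨J, hJ, hJmax⟩ := (Ideal.isDiracGraded_span_singleton (𝒜 := 𝒜)
      (sub_mem SetLike.GradedOne.one_mem hc0)).exists_le_maximal hproper
    obtain rfl := huniq J hJmax.prop.1 hJmax.prop.2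
      fun K hK hK' hle => (hJmax.eq_of_le ⟨hK, hK'⟩ hle).symm
    refine hne ((Ideal.eq_top_iff_one _).mpr ?_)
    simpa using add_mem (hJ (Ideal.mem_span_singleton_self _)) hc
  obtain ⟨s, hs, hspan⟩ := hfg
  induction s using Finset.cons_induction with
  | empty =>
    intro y
    have hy : y ∈ Submodule.span A ((∅ : Finset M) : Set M) := hspan ▸ Submodule.mem_top
    simpa using hy
  | cons x s hxs ih =>
    have hs' : ∀ y ∈ s, ∃ k : ℤ, y ∈ ℳ k := fun y hy => hs y (Finset.mem_cons_of_mem hy)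
    rw [Finset.coe_cons] at hspan
    suffices hx : x ∈ Submodule.span A (s : Set M) from
      ih hs' (by rw [← hspan, Submodule.span_insert_eq_span hx])
    have hdecomp (y : M) : ∃ b ∈ m, ∃ w ∈ Submodule.span A (s : Set M), y = b • x + w := by
      induction hmM y using AddSubmonoid.closure_induction with
      | mem _ h =>
        obtain ⟨a, ha, z, rfl⟩ := h
        have hz : z ∈ Submodule.span A (insert x (s : Set M)) := hspan ▸ Submodule.mem_top
        obtain ⟨e, w, hw, rfl⟩ := Submodule.mem_span_insert.mp hz
        exact ⟨a * e, hgr.mul_mem_right ha e, a • w, Submodule.smul_mem _ _ hw,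
          by rw [smul_add, smul_smul]⟩
      | zero => exact ⟨0, zero_mem _, 0, zero_mem _, by simp⟩
      | add _ _ _ _ h₁ h₂ =>
        obtain ⟨b₁, hb₁, w₁, hw₁, rfl⟩ := h₁
        obtain ⟨b₂, hb₂, w₂, hw₂, rfl⟩ := h₂
        exact ⟨b₁ + b₂, add_mem hb₁ hb₂, w₁ + w₂, add_mem hw₁ hw₂, by rw [add_smul]; abel⟩
    obtain ⟨d, hd⟩ := hs x (Finset.mem_cons_self x s)
    obtain ⟨b, hb, w, hw, hxw⟩ := hdecomp x
    have hcomp : x = (DirectSum.decompose 𝒜 b 0 : A) • x + (DirectSum.decompose ℳ w d : M) := by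
      rw [← sub_self d]
      have h := congrArg (fun y => (DirectSum.decompose ℳ y d : M)) hxw
      simpa [-sub_self, DirectSum.decompose_add, DirectSum.decompose_of_mem_same ℳ hd,
        DirectSum.coe_decompose_smul_of_right_mem 𝒜 ℳ hsmul b hd] using h
    obtain ⟨u, hu⟩ := hinv (hgr b hb 0) (SetLike.coe_mem _)
    have hx : x = u • (DirectSum.decompose ℳ w d : M) := by
      rw [← sub_eq_iff_eq_add'.mpr hcomp]
      nth_rw 2 [← one_smul A x]
      rw [← sub_smul, smul_smul, hu, one_smul]
    rw [hx]
    exact Submodule.smul_mem _ _ (DirectSum.coe_decompose_mem_span 𝒜 ℳ hsmul hs' hw d)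
end

section
/- (Transitivity of integrality.) Let φ : A → B be a map of Dirac rings, and let B′ ⊆ B be a subring containing φ(A), closed under taking homogeneous components, and such that every homogeneous element of B′ is integral over A. If a homogeneous element y ∈ B is integral over B′ (with respect to the inclusion B′ → B, where B′ carries the grading (B′)_k = B′ ∩ B_k), then y is integral over A. -/
/-- A map of Dirac rings: a ring homomorphism preserving the grading. -/
def IsDiracHom {A B : Type*} [Ring A] [Ring B]
    (𝒜 : ℤ → AddSubgroup A) (ℬ : ℤ → AddSubgroup B) (f : A →+* B) : Prop :=
  ∀ k : ℤ, ∀ a ∈ 𝒜 k, f a ∈ ℬ k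

/-- A homogeneous element `y` of degree `e` of a Dirac `A`-algebra is integral over `A`
if it is a root of a monic homogeneous polynomial: there are `n ≥ 1` and homogeneous
`a_i ∈ A` of degree `(n - i)·e` with `yⁿ + φ(a_{n-1})·y^{n-1} + ⋯ + φ(a_0) = 0`. -/
def DiracIntegralAt {A B : Type*} [Ring A] [Ring B]
    (𝒜 : ℤ → AddSubgroup A) (φ : A →+* B) (e : ℤ) (y : B) : Prop :=
  ∃ n : ℕ, 1 ≤ n ∧ ∃ a : ℕ → A,
    (∀ i < n, a i ∈ 𝒜 (((n : ℤ) - (i : ℤ)) * e)) ∧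
    y ^ n + ∑ i ∈ Finset.range n, φ (a i) * y ^ i = 0

theorem sum_range_two_mul {M : Type*} [AddCommMonoid M] (f : ℕ → M) (n : ℕ) :
    ∑ i ∈ Finset.range (2 * n), f i =
      ∑ i ∈ Finset.range n, f (2 * i) + ∑ i ∈ Finset.range n, f (2 * i + 1) := by
  induction n with
  | zero => simp
  | succ n ih =>
    rw [Nat.mul_succ, Finset.sum_range_succ, Finset.sum_range_succ, ih, Finset.sum_range_succ,
      Finset.sum_range_succ]
    abel

open Polynomial in
/-- An element killed by the monic polynomial `(X ^ m + ∑ cᵢ X ^ i) ^ 2 + ∑ dᵢⱼ X ^ (i + j + 1)`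
with integral coefficients is integral. -/
theorem isIntegralElem_of_sq_add_eq_zero {R E : Type*} [CommRing R] [CommRing E]
    (f : R →+* E) (m : ℕ) (c : ℕ → E) (d : ℕ → ℕ → E) (hc : ∀ i, f.IsIntegralElem (c i))
    (hd : ∀ i j, f.IsIntegralElem (d i j)) (z : E)
    (hz : (z ^ m + ∑ i ∈ Finset.range m, c i * z ^ i) ^ 2 +
      ∑ i ∈ Finset.range m, ∑ j ∈ Finset.range m, d i j * z ^ (i + j + 1) = 0) :
    f.IsIntegralElem z := by
  rcases subsingleton_or_nontrivial E with _ | _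
  · exact Subsingleton.elim 0 z ▸ RingHom.isIntegralElem_zero f
  algebraize [f]
  let c' : ℕ → integralClosure R E := fun i => ⟨c i, hc i⟩
  let d' : ℕ → ℕ → integralClosure R E := fun i j => ⟨d i j, hd i j⟩
  have hz' : IsIntegral (integralClosure R E) z := by
    have hlt : ∀ i ∈ Finset.range m, i < m := fun i hi => Finset.mem_range.1 hi
    have hlow : (∑ i ∈ Finset.range m, C (c' i) * X ^ i).degree < (m : WithBot ℕ) :=
      (degree_sum_le _ _).trans_lt <| (Finset.sup_lt_iff (WithBot.bot_lt_coe m)).2 fun i hi =>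
        (degree_C_mul_X_pow_le _ _).trans_lt (WithBot.coe_lt_coe.2 (hlt i hi))
    have hP : (X ^ m + ∑ i ∈ Finset.range m, C (c' i) * X ^ i).Monic := monic_X_pow_add hlow
    have hPdeg : (X ^ m + ∑ i ∈ Finset.range m, C (c' i) * X ^ i).degree = m := by
      rw [degree_add_eq_left_of_degree_lt (by rwa [degree_X_pow]), degree_X_pow]
    refine ⟨(X ^ m + ∑ i ∈ Finset.range m, C (c' i) * X ^ i) ^ 2 +
      ∑ i ∈ Finset.range m, ∑ j ∈ Finset.range m, C (d' i j) * X ^ (i + j + 1), ?_, ?_⟩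
    · refine (hP.pow 2).add_of_left ?_
      rw [degree_pow' (by simp [hP.leadingCoeff]), hPdeg]
      have hbot : (⊥ : WithBot ℕ) < 2 • (m : WithBot ℕ) := by
        rw [two_nsmul]; exact_mod_cast WithBot.bot_lt_coe (m + m)
      refine (degree_sum_le _ _).trans_lt ((Finset.sup_lt_iff hbot).2 fun i hi => ?_)
      refine (degree_sum_le _ _).trans_lt ((Finset.sup_lt_iff hbot).2 fun j hj => ?_)
      refine (degree_C_mul_X_pow_le _ _).trans_lt ?_
      have := hlt i hi
      have := hlt j hj
      rw [two_nsmul]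
      exact_mod_cast (by omega : i + j + 1 < m + m)
    · simpa [eval₂_finsetSum, c', d'] using hz
  exact isIntegral_trans (R := R) z hz'

namespace DiracRing

open scoped IsMulCommutative

variable {A B : Type*} [Ring A] [Ring B] (𝒜 : ℤ → AddSubgroup A) (ℬ : ℤ → AddSubgroup B)

/-- The subring generated by the homogeneous elements of even degree. -/
def evenSubring : Subring A :=
  Subring.closure {x | ∃ k, Even k ∧ x ∈ 𝒜 k}

variable {𝒜 ℬ}

theorem mem_evenSubring {k : ℤ} (hk : Even k) {x : A} (hx : x ∈ 𝒜 k) : x ∈ evenSubring 𝒜 :=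
  Subring.subset_closure ⟨k, hk, hx⟩

theorem mul_comm_of_even [DiracRing 𝒜] {i j : ℤ} (hi : Even i) {a b : A} (ha : a ∈ 𝒜 i)
    (hb : b ∈ 𝒜 j) : a * b = b * a := by
  rw [koszul ha hb]
  obtain ⟨k, hk⟩ := hi.mul_right j
  simp [hk, zpow_add, Int.units_mul_self]

theorem mul_anticomm_of_odd [DiracRing 𝒜] {i j : ℤ} (hi : Odd i) (hj : Odd j) {a b : A}
    (ha : a ∈ 𝒜 i) (hb : b ∈ 𝒜 j) : a * b = -(b * a) := by
  rw [koszul ha hb]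
  obtain ⟨k, hk⟩ := hi.mul hj
  simp [hk, zpow_add, zpow_mul]

instance [DiracRing 𝒜] : IsMulCommutative (evenSubring 𝒜) :=
  Subring.isMulCommutative_closure fun _ ⟨_, hi, ha⟩ _ ⟨_, _, hb⟩ => mul_comm_of_even hi ha hb

/-- The restriction of a map of Dirac rings to the even subrings. -/
def evenHom {φ : A →+* B} (hφ : IsDiracHom 𝒜 ℬ φ) : evenSubring 𝒜 →+* evenSubring ℬ :=
  φ.restrict _ _ fun x hx => by
    have : evenSubring 𝒜 ≤ (evenSubring ℬ).comap φ :=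
      Subring.closure_le.2 fun x ⟨k, hk, hx⟩ => mem_evenSubring hk (hφ k x hx)
    exact this hx

variable [DiracRing 𝒜] [DiracRing ℬ] {φ : A →+* B}

/-- `x` lies in the even subring of the target and is integral over that of the source. -/
def IsEvenIntegral (hφ : IsDiracHom 𝒜 ℬ φ) (x : B) : Prop :=
  ∃ hx : x ∈ evenSubring ℬ, (evenHom hφ).IsIntegralElem ⟨x, hx⟩

theorem IsEvenIntegral.of_sq_add_eq_zero (hφ : IsDiracHom 𝒜 ℬ φ) (m : ℕ) (c : ℕ → B)
    (d : ℕ → ℕ → B) (hc : ∀ i < m, IsEvenIntegral hφ (c i))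
    (hd : ∀ i < m, ∀ j < m, IsEvenIntegral hφ (d i j)) {z : B} (hzmem : z ∈ evenSubring ℬ)
    (hz : (z ^ m + ∑ i ∈ Finset.range m, c i * z ^ i) ^ 2 +
      ∑ i ∈ Finset.range m, ∑ j ∈ Finset.range m, d i j * z ^ (i + j + 1) = 0) :
    IsEvenIntegral hφ z := by
  let c' : ℕ → evenSubring ℬ := fun i => if hi : i < m then ⟨c i, (hc i hi).1⟩ else 0
  let d' : ℕ → ℕ → evenSubring ℬ := fun i j =>
    if h : i < m ∧ j < m then ⟨d i j, (hd i h.1 j h.2).1⟩ else 0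
  refine ⟨hzmem, isIntegralElem_of_sq_add_eq_zero _ m c' d' (fun i => ?_)
    (fun i j => ?_) _ ?_⟩
  · by_cases hi : i < m
    · simpa only [c', dif_pos hi] using (hc i hi).2
    · simpa only [c', dif_neg hi] using RingHom.isIntegralElem_zero _
  · by_cases h : i < m ∧ j < m
    · simpa only [d', dif_pos h] using (hd i h.1 j h.2).2
    · simpa only [d', dif_neg h] using RingHom.isIntegralElem_zero _
  · apply Subtype.ext
    refine Eq.trans ?_ hz
    push_cast
    congr 1
    · congr 2
      refine Finset.sum_congr rfl fun i hi => ?_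
      simp only [c', dif_pos (Finset.mem_range.1 hi)]
    · refine Finset.sum_congr rfl fun i hi => Finset.sum_congr rfl fun j hj => ?_
      simp only [d', dif_pos (And.intro (Finset.mem_range.1 hi) (Finset.mem_range.1 hj))]

theorem IsEvenIntegral.of_add_eq_zero (hφ : IsDiracHom 𝒜 ℬ φ) (m : ℕ) (c : ℕ → B)
    (hc : ∀ i < m, IsEvenIntegral hφ (c i)) {z : B} (hzmem : z ∈ evenSubring ℬ)
    (hz : z ^ m + ∑ i ∈ Finset.range m, c i * z ^ i = 0) : IsEvenIntegral hφ z :=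
  .of_sq_add_eq_zero hφ m c 0 hc
    (fun _ _ _ _ => ⟨zero_mem _, RingHom.isIntegralElem_zero _⟩) hzmem (by simp [hz])

theorem isEvenIntegral_of_diracIntegralAt (hφ : IsDiracHom 𝒜 ℬ φ) {k : ℤ} (hk : Even k) {x : B}
    (hx : x ∈ ℬ k) (h : DiracIntegralAt 𝒜 φ k x) : IsEvenIntegral hφ x := by
  obtain ⟨n, -, a, ha, hn⟩ := h
  refine .of_add_eq_zero hφ n _ (fun i hi => ?_) (mem_evenSubring hk hx) hn
  exact ⟨_, RingHom.isIntegralElem_map (evenHom hφ)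
    (x := ⟨a i, mem_evenSubring (hk.mul_left _) (ha i hi)⟩)⟩

theorem coe_decompose_map (hφ : IsDiracHom 𝒜 ℬ φ) (x : A) (k : ℤ) :
    (DirectSum.decompose ℬ (φ x) k : B) = φ (DirectSum.decompose 𝒜 x k) := by
  induction x using DirectSum.Decomposition.inductionOn 𝒜 with
  | zero => simp
  | @homogeneous i a =>
    by_cases h : i = k
    · subst h
      rw [DirectSum.decompose_of_mem_same _ (hφ _ _ a.2), DirectSum.decompose_of_mem_same _ a.2]
    · rw [DirectSum.decompose_of_mem_ne _ (hφ _ _ a.2) h, DirectSum.decompose_of_mem_ne _ a.2 h,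
        map_zero]
  | add a b ha hb => simp [DirectSum.decompose_add, ha, hb]

/-- A monic relation may be replaced by its homogeneous component of top degree. -/
theorem IsEvenIntegral.diracIntegralAt {hφ : IsDiracHom 𝒜 ℬ φ} {k : ℤ} {x : B}
    (h : IsEvenIntegral hφ x) (hx : x ∈ ℬ k) : DiracIntegralAt 𝒜 φ k x := by
  obtain ⟨_, p, hp, hp0⟩ := h
  replace hp0 := congrArg (evenSubring ℬ).subtype hp0
  set n := p.natDegree
  have hrel : x ^ (n + 1) + ∑ i ∈ Finset.range n, φ (p.coeff i : A) * x ^ (i + 1) = 0 := by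
    rw [Polynomial.eval₂_eq_sum_range, Finset.sum_range_succ, hp.coeff_natDegree, map_one,
      one_mul, map_add, map_sum, map_pow, map_zero] at hp0
    have := congrArg (· * x) hp0
    simp only [add_mul, Finset.sum_mul, zero_mul] at this
    rw [add_comm, pow_succ x n, ← this]
    congr 1
    refine Finset.sum_congr rfl fun i _ => ?_
    rw [map_mul, map_pow, pow_succ, ← mul_assoc]
    rfl
  refine ⟨n + 1, by omega, fun i => if i = 0 then 0 else
    (DirectSum.decompose 𝒜 (p.coeff (i - 1) : A) (((n + 1 : ℕ) - (i : ℤ)) * k) : A), ?_, ?_⟩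
  · intro i _
    dsimp only
    split_ifs
    exacts [zero_mem _, SetLike.coe_mem _]
  · have hpow : ∀ i : ℕ, x ^ i ∈ ℬ ((i : ℤ) * k) := fun i => by
      simpa using SetLike.pow_mem_graded i hx
    have := congrArg (fun b => (DirectSum.decompose ℬ b (((n + 1 : ℕ) : ℤ) * k) : B)) hrel
    simp only [DirectSum.decompose_add, DirectSum.decompose_sum, DirectSum.add_apply,
      DirectSum.sum_apply, AddSubgroup.coe_add, AddSubgroup.val_finsetSum,
      DirectSum.decompose_zero, DirectSum.zero_apply, AddSubgroup.coe_zero,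
      DirectSum.decompose_of_mem_same ℬ (hpow (n + 1))] at this
    rw [← this, Finset.sum_range_succ']
    simp only [if_true, map_zero, zero_mul, add_zero, Nat.succ_ne_zero, if_false]
    congr 1
    refine Finset.sum_congr rfl fun i _ => ?_
    rw [Nat.add_sub_cancel, ← coe_decompose_map hφ,
      ← DirectSum.coe_decompose_mul_add_of_right_mem ℬ (hpow (i + 1))]
    rw [← add_mul, sub_add_cancel]

/-- A monic relation for an element of odd degree yields one for its square, by separating the
even and the odd coefficients and squaring. -/
theorem sq_add_eq_zero_of_odd {e : ℤ} (he : Odd e) {y : B} (hy : y ∈ ℬ e) (m : ℕ) (a : ℕ → B)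
    (ha : ∀ i < 2 * m, a i ∈ ℬ ((((2 * m : ℕ) : ℤ) - i) * e))
    (h : y ^ (2 * m) + ∑ i ∈ Finset.range (2 * m), a i * y ^ i = 0) :
    ((y ^ 2) ^ m + ∑ i ∈ Finset.range m, a (2 * i) * (y ^ 2) ^ i) ^ 2 +
      ∑ i ∈ Finset.range m, ∑ j ∈ Finset.range m,
        a (2 * i + 1) * a (2 * j + 1) * (y ^ 2) ^ (i + j + 1) = 0 := by
  have hodd : ∀ i < m, Odd ((((2 * m : ℕ) : ℤ) - ((2 * i + 1 : ℕ) : ℤ)) * e) := fun i _ =>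
    Odd.mul ⟨(m : ℤ) - i - 1, by push_cast; ring⟩ he
  have hsq : y ^ 2 ∈ ℬ (e + e) := by
    rw [pow_two]; exact SetLike.mul_mem_graded hy hy
  have hcomm : ∀ j < m, ∀ i, Commute ((y ^ 2) ^ i) (a (2 * j + 1)) := fun j hj i =>
    Commute.pow_left (mul_comm_of_even ⟨e, rfl⟩ hsq (ha _ (by omega))) i
  set q := ∑ i ∈ Finset.range m, a (2 * i + 1) * (y ^ 2) ^ i with hq
  have hqy : q * y = -(y * q) := by
    rw [hq, Finset.sum_mul, Finset.mul_sum, ← Finset.sum_neg_distrib]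
    refine Finset.sum_congr rfl fun i hi => ?_
    have hi := Finset.mem_range.1 hi
    rw [mul_assoc, (((Commute.refl y).pow_left 2).pow_left i).eq, ← mul_assoc,
      mul_anticomm_of_odd (hodd i hi) he (ha _ (by omega)) hy, neg_mul, mul_assoc]
  have hqq : ∑ i ∈ Finset.range m, ∑ j ∈ Finset.range m,
      a (2 * i + 1) * a (2 * j + 1) * (y ^ 2) ^ (i + j + 1) = q * q * y ^ 2 := by
    rw [hq, Finset.sum_mul_sum, Finset.sum_mul]
    refine Finset.sum_congr rfl fun i _ => ?_
    rw [Finset.sum_mul]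
    refine Finset.sum_congr rfl fun j hj => ?_
    rw [pow_succ, pow_add, mul_assoc (a _) ((y ^ 2) ^ i), ← mul_assoc ((y ^ 2) ^ i),
      (hcomm j (Finset.mem_range.1 hj) i).eq]
    simp only [mul_assoc]
  have hp : (y ^ 2) ^ m + ∑ i ∈ Finset.range m, a (2 * i) * (y ^ 2) ^ i = -(q * y) := by
    rw [sum_range_two_mul, ← add_assoc] at h
    rw [eq_neg_iff_add_eq_zero, ← h, hq, Finset.sum_mul]
    simp only [pow_mul, pow_succ _ (2 * _), mul_assoc]
  rw [hp, hqq, neg_sq, pow_two (q * y), ← mul_assoc, mul_assoc q y q,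
    show y * q = -(q * y) by rw [hqy, neg_neg]]
  simp [mul_assoc, pow_two]

end DiracRing

theorem DiracIntegralAt.of_sq {A B : Type*} [Ring A] [Ring B] {𝒜 : ℤ → AddSubgroup A}
    {φ : A →+* B} {e : ℤ} {y : B} (h : DiracIntegralAt 𝒜 φ (e + e) (y ^ 2)) :
    DiracIntegralAt 𝒜 φ e y := by
  obtain ⟨n, hn, a, ha, h0⟩ := h
  refine ⟨2 * n, by omega, fun i => if Even i then a (i / 2) else 0, ?_, ?_⟩
  · intro i hi
    dsimp only
    split_ifs with h
    · obtain ⟨j, rfl⟩ := h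
      rw [show (j + j) / 2 = j by omega]
      convert ha j (by omega) using 2
      push_cast
      ring
    · exact zero_mem _
  · rw [← h0, pow_mul, sum_range_two_mul]
    simp [pow_mul]

/-- transitivity of integrality: if `B' ⊆ B` is a subring containing
`φ(A)`, closed under homogeneous components, all of whose homogeneous elements are
integral over `A`, and if a homogeneous element `y ∈ B` of degree `e` is integral over
`B'` (with the induced grading `(B')_k = B' ∩ B_k`), then `y` is integral over `A`. -/
theorem dirac_integral_trans
    {A B : Type*} [Ring A] [Ring B]
    (𝒜 : ℤ → AddSubgroup A) (ℬ : ℤ → AddSubgroup B) [DiracRing 𝒜] [DiracRing ℬ]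
    (φ : A →+* B) (hφ : IsDiracHom 𝒜 ℬ φ)
    (B' : Subring B) (hrange : Set.range φ ⊆ (B' : Set B))
    (hcomp : ∀ x ∈ B', ∀ k : ℤ, ((DirectSum.decompose ℬ x) k : B) ∈ B')
    (hint : ∀ (k : ℤ) (x : B), x ∈ B' → x ∈ ℬ k → DiracIntegralAt 𝒜 φ k x)
    (e : ℤ) (y : B) (hy : y ∈ ℬ e)
    (hyint : ∃ n : ℕ, 1 ≤ n ∧ ∃ a : ℕ → B,
      (∀ i < n, a i ∈ B' ∧ a i ∈ ℬ (((n : ℤ) - (i : ℤ)) * e)) ∧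
      y ^ n + ∑ i ∈ Finset.range n, a i * y ^ i = 0) :
    DiracIntegralAt 𝒜 φ e y := by
  obtain ⟨n, -, a, ha, h0⟩ := hyint
  rcases Int.even_or_odd e with he | he
  · refine (DiracRing.IsEvenIntegral.of_add_eq_zero hφ n a (fun i hi => ?_)
      (DiracRing.mem_evenSubring he hy) h0).diracIntegralAt hy
    exact DiracRing.isEvenIntegral_of_diracIntegralAt hφ (he.mul_left _) (ha i hi).2
      (hint _ _ (ha i hi).1 (ha i hi).2)
  · obtain ⟨m, a, ha, h0⟩ : ∃ (m : ℕ) (a : ℕ → B),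
        (∀ i < 2 * m, a i ∈ B' ∧ a i ∈ ℬ ((((2 * m : ℕ) : ℤ) - i) * e)) ∧
        y ^ (2 * m) + ∑ i ∈ Finset.range (2 * m), a i * y ^ i = 0 := by
      obtain ⟨m, rfl | rfl⟩ := n.even_or_odd'
      · exact ⟨m, a, ha, h0⟩
      · refine ⟨m + 1, fun i => if i = 0 then 0 else a (i - 1), fun i hi => ?_, ?_⟩
        · dsimp only
          split_ifs with hi0
          · exact ⟨zero_mem _, zero_mem _⟩
          · obtain ⟨j, rfl⟩ := Nat.exists_eq_succ_of_ne_zero hi0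
            have hdeg : (((2 * (m + 1) : ℕ) : ℤ) - (j.succ : ℕ)) * e =
                (((2 * m + 1 : ℕ) : ℤ) - j) * e := by push_cast; ring
            rw [hdeg]
            exact ha j (by omega)
        · have := congrArg (· * y) h0
          simp only [add_mul, Finset.sum_mul, zero_mul] at this
          rw [show 2 * (m + 1) = 2 * m + 1 + 1 by ring, Finset.sum_range_succ']
          simpa [pow_succ, mul_assoc] using this
    have hsq : y ^ 2 ∈ ℬ (e + e) := by
      rw [pow_two]; exact SetLike.mul_mem_graded hy hy
    refine DiracIntegralAt.of_sq ((DiracRing.IsEvenIntegral.of_sq_add_eq_zero hφ m _ _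
      (fun i hi => ?_) (fun i hi j hj => ?_) (DiracRing.mem_evenSubring ⟨e, rfl⟩ hsq)
      (DiracRing.sq_add_eq_zero_of_odd he hy m a (fun i hi => (ha i hi).2) h0)).diracIntegralAt hsq)
    · obtain ⟨h1, h2⟩ := ha (2 * i) (by omega)
      refine DiracRing.isEvenIntegral_of_diracIntegralAt hφ (Even.mul_right ?_ e) h2
        (hint _ _ h1 h2)
      exact ⟨(m : ℤ) - i, by push_cast; ring⟩
    · obtain ⟨h1, h2⟩ := ha (2 * i + 1) (by omega)
      obtain ⟨h3, h4⟩ := ha (2 * j + 1) (by omega)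
      have h5 := SetLike.mul_mem_graded h2 h4
      refine DiracRing.isEvenIntegral_of_diracIntegralAt hφ ?_ h5 (hint _ _ (mul_mem h1 h3) h5)
      rw [← add_mul]
      exact Even.mul_right ⟨2 * (m : ℤ) - i - j - 1, by push_cast; ring⟩ e
end
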